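/- arXiv:1508.01665 — 5 statements merged into one kernel-verified Lean document; each statement's English description precedes it below -/
import Mathlib

section
/- For all integers x, x', n, n' and every real number t, the equal-time kernel satisfies K_t(x,n;x'+1,n'−1) = K_t(x,n;x'+1,n') − K_t(x,n;x',n') + δ, where δ = 1 if both n = n'−1 and x = x'+1, and δ = 0 otherwise. -/
open MeasureTheory

/-- The equal-time correlation kernel `K_t(x,n;x',n')` of the Borodin–Ferrari model. -/
noncomputable def Kt (t : ℝ) (x n x' n' : ℤ) : ℂ :=
  -(if n < n' then (1 : ℂ) else 0) * (2 * (Real.pi : ℂ) * Complex.I)⁻¹ *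
    (∮ w in C(0, 1/2), w ^ (x - x' - 1) * (1 - w) ^ (n - n'))
  + ((2 * (Real.pi : ℂ) * Complex.I) ^ 2)⁻¹ *
    (∮ w in C(0, 1/2), ∮ z in C(1, 1/4),
      Complex.exp ((t : ℂ) / w - (t : ℂ) / z) * (1 - w) ^ n * (1 - z) ^ (-n') *
        w ^ x * z ^ (-x' - 1) * (w - z)⁻¹)

theorem circleMap_half_ne_zero (θ : ℝ) : circleMap 0 (1 / 2) θ ≠ 0 :=
  circleMap_ne_center (by norm_num)

theorem one_sub_circleMap_half_ne_zero (θ : ℝ) : 1 - circleMap 0 (1 / 2) θ ≠ 0 := by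
  intro h
  have h1 : ‖circleMap 0 (1 / 2) θ‖ = 1 / 2 := by simp
  rw [← sub_eq_zero.mp h] at h1
  norm_num at h1

theorem one_sub_circleMap_quarter_ne_zero (φ : ℝ) : 1 - circleMap 1 (1 / 4) φ ≠ 0 :=
  sub_ne_zero.mpr (circleMap_ne_center (by norm_num)).symm

theorem norm_circleMap_quarter_ge (φ : ℝ) : 3 / 4 ≤ ‖circleMap 1 (1 / 4) φ‖ := by
  have h1 : ‖(1 : ℂ) - circleMap 1 (1 / 4) φ‖ = 1 / 4 := by
    simp [circleMap]
  have h2 := norm_sub_norm_le (1 : ℂ) (circleMap 1 (1 / 4) φ)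
  rw [h1, norm_one] at h2
  linarith

theorem circleMap_quarter_ne_zero (φ : ℝ) : circleMap 1 (1 / 4) φ ≠ 0 :=
  norm_pos_iff.mp (by linarith [norm_circleMap_quarter_ge φ])

theorem circleMap_half_sub_circleMap_quarter_ne_zero (θ φ : ℝ) :
    circleMap 0 (1 / 2) θ - circleMap 1 (1 / 4) φ ≠ 0 := by
  intro h
  have h1 : ‖circleMap 0 (1 / 2) θ‖ = 1 / 2 := by simp
  have h2 := norm_circleMap_quarter_ge φ
  rw [← sub_eq_zero.mp h, h1] at h2
  norm_num at h2

/-- The integrand of the double contour integral in `Kt`. -/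
noncomputable def doubleIntegrand (t : ℝ) (x n x' n' : ℤ) (w z : ℂ) : ℂ :=
  Complex.exp ((t : ℂ) / w - (t : ℂ) / z) * (1 - w) ^ n * (1 - z) ^ (-n') *
    w ^ x * z ^ (-x' - 1) * (w - z)⁻¹

theorem continuous_doubleIntegrand_circleMap (t : ℝ) (x n x' n' : ℤ) :
    Continuous fun p : ℝ × ℝ => doubleIntegrand t x n x' n'
      (circleMap 0 (1 / 2) p.1) (circleMap 1 (1 / 4) p.2) := by
  have hw : Continuous fun p : ℝ × ℝ => circleMap 0 (1 / 2) p.1 :=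
    (continuous_circleMap _ _).comp continuous_fst
  have hz : Continuous fun p : ℝ × ℝ => circleMap 1 (1 / 4) p.2 :=
    (continuous_circleMap _ _).comp continuous_snd
  unfold doubleIntegrand
  refine Continuous.mul (Continuous.mul (Continuous.mul (Continuous.mul (Continuous.mul
    (Complex.continuous_exp.comp (Continuous.sub ?_ ?_)) ?_) ?_) ?_) ?_) ?_
  · exact continuous_const.div hw fun p => circleMap_half_ne_zero p.1
  · exact continuous_const.div hz fun p => circleMap_quarter_ne_zero p.2
  · exact (continuous_const.sub hw).zpow₀ _ fun p => Or.inl (one_sub_circleMap_half_ne_zero p.1)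
  · exact (continuous_const.sub hz).zpow₀ _ fun p =>
      Or.inl (one_sub_circleMap_quarter_ne_zero p.2)
  · exact hw.zpow₀ _ fun p => Or.inl (circleMap_half_ne_zero p.1)
  · exact hz.zpow₀ _ fun p => Or.inl (circleMap_quarter_ne_zero p.2)
  · exact (hw.sub hz).inv₀ fun p => circleMap_half_sub_circleMap_quarter_ne_zero p.1 p.2

theorem circleIntegrable_doubleIntegrand (t : ℝ) (x n x' n' : ℤ) (θ : ℝ) :
    CircleIntegrable (doubleIntegrand t x n x' n' (circleMap 0 (1 / 2) θ)) 1 (1 / 4) :=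
  ((continuous_doubleIntegrand_circleMap t x n x' n').comp
    (continuous_const.prodMk continuous_id : Continuous fun φ : ℝ => (θ, φ))).intervalIntegrable _ _

theorem circleIntegrable_circleIntegral_doubleIntegrand (t : ℝ) (x n x' n' : ℤ) :
    CircleIntegrable (fun w => ∮ z in C(1, 1/4), doubleIntegrand t x n x' n' w z) 0 (1 / 2) := by
  refine Continuous.intervalIntegrable ?_ _ _
  refine intervalIntegral.continuous_parametric_intervalIntegral_of_continuous' ?_ _ _
  simp only [deriv_circleMap]
  exact (((continuous_circleMap _ _).comp continuous_snd).mul continuous_const).smul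
    (continuous_doubleIntegrand_circleMap t x n x' n')

theorem doubleIntegrand_succ_pred (t : ℝ) (x n x' n' : ℤ) (w : ℂ) {z : ℂ}
    (hz : z ≠ 0) (hz' : 1 - z ≠ 0) :
    doubleIntegrand t x n (x' + 1) (n' - 1) w z =
      doubleIntegrand t x n (x' + 1) n' w z - doubleIntegrand t x n x' n' w z := by
  have h1 : (1 - z) ^ (-(n' - 1)) = (1 - z) ^ (-n') * (1 - z) := by
    rw [← zpow_add_one₀ hz']; congr 1; ring
  have h2 : z ^ (-x' - 1) = z ^ (-(x' + 1) - 1) * z := by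
    rw [← zpow_add_one₀ hz]; congr 1; ring
  unfold doubleIntegrand
  rw [h1, h2]
  ring

theorem circleIntegral_doubleIntegrand_succ_pred (t : ℝ) (x n x' n' : ℤ) :
    (∮ w in C(0, 1/2), ∮ z in C(1, 1/4), doubleIntegrand t x n (x' + 1) (n' - 1) w z) =
      (∮ w in C(0, 1/2), ∮ z in C(1, 1/4), doubleIntegrand t x n (x' + 1) n' w z) -
        ∮ w in C(0, 1/2), ∮ z in C(1, 1/4), doubleIntegrand t x n x' n' w z := by
  rw [← circleIntegral.integral_sub (circleIntegrable_circleIntegral_doubleIntegrand ..)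
    (circleIntegrable_circleIntegral_doubleIntegrand ..)]
  refine intervalIntegral.integral_congr fun θ _ => ?_
  simp only
  rw [← circleIntegral.integral_sub (circleIntegrable_doubleIntegrand ..)
    (circleIntegrable_doubleIntegrand ..)]
  congr 1
  refine intervalIntegral.integral_congr fun φ _ => ?_
  simp only
  rw [doubleIntegrand_succ_pred t x n x' n' _ (circleMap_quarter_ne_zero φ)
    (one_sub_circleMap_quarter_ne_zero φ)]

theorem circleIntegrable_zpow_mul_one_sub_zpow (a b : ℤ) :
    CircleIntegrable (fun w : ℂ => w ^ a * (1 - w) ^ b) 0 (1 / 2) :=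
  (((continuous_circleMap _ _).zpow₀ _ fun θ => Or.inl (circleMap_half_ne_zero θ)).mul
    ((continuous_const.sub (continuous_circleMap _ _)).zpow₀ _ fun θ =>
      Or.inl (one_sub_circleMap_half_ne_zero θ))).intervalIntegrable _ _

theorem circleIntegral_zpow_mul_one_sub_zpow_succ (a b : ℤ) :
    (∮ w in C(0, 1/2), w ^ a * (1 - w) ^ (b + 1)) =
      (∮ w in C(0, 1/2), w ^ a * (1 - w) ^ b) - ∮ w in C(0, 1/2), w ^ (a + 1) * (1 - w) ^ b := by
  rw [← circleIntegral.integral_sub (circleIntegrable_zpow_mul_one_sub_zpow ..)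
    (circleIntegrable_zpow_mul_one_sub_zpow ..)]
  refine intervalIntegral.integral_congr fun θ _ => ?_
  simp only
  rw [zpow_add_one₀ (one_sub_circleMap_half_ne_zero θ), zpow_add_one₀ (circleMap_half_ne_zero θ)]
  congr 1
  ring

theorem circleIntegral_zpow (a : ℤ) :
    (∮ w in C(0, 1/2), w ^ a) = if a = -1 then 2 * (Real.pi : ℂ) * Complex.I else 0 := by
  split_ifs with h
  · subst h
    simpa using circleIntegral.integral_sub_center_inv 0 (R := 1 / 2) (by norm_num)
  · simpa using circleIntegral.integral_sub_zpow_of_ne h 0 0 (1 / 2)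

theorem kernel_identity_A (t : ℝ) (x x' n n' : ℤ) :
    Kt t x n (x' + 1) (n' - 1) =
      Kt t x n (x' + 1) n' - Kt t x n x' n' +
        (if n = n' - 1 ∧ x = x' + 1 then (1 : ℂ) else 0) := by
  have hdouble := circleIntegral_doubleIntegrand_succ_pred t x n x' n'
  have hsingle := circleIntegral_zpow_mul_one_sub_zpow_succ (x - (x' + 1) - 1) (n - n')
  rw [show x - (x' + 1) - 1 + 1 = x - x' - 1 by ring] at hsingle
  unfold doubleIntegrand at hdouble
  unfold Kt
  rw [hdouble, show n - (n' - 1) = n - n' + 1 by ring]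
  rcases lt_trichotomy n (n' - 1) with h | h | h
  · rw [if_pos h, if_pos (by omega), if_neg (by omega), hsingle]
    ring
  · have hpi : (2 * (Real.pi : ℂ) * Complex.I) ≠ 0 := Complex.two_pi_I_ne_zero
    rw [show n - n' + 1 = 0 by omega] at hsingle
    simp only [zpow_zero, mul_one, circleIntegral_zpow] at hsingle
    have hδ : (if n = n' - 1 ∧ x = x' + 1 then (1 : ℂ) else 0) =
        (2 * (Real.pi : ℂ) * Complex.I)⁻¹ *
          if x - (x' + 1) - 1 = -1 then 2 * (Real.pi : ℂ) * Complex.I else 0 := by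
      by_cases hx : x = x' + 1
      · rw [if_pos ⟨h, hx⟩, if_pos (by omega), inv_mul_cancel₀ hpi]
      · rw [if_neg (by omega), if_neg (by omega), mul_zero]
    rw [if_neg (by omega), if_pos (by omega), hδ, hsingle]
    ring
  · rw [if_neg (by omega), if_neg (by omega), if_neg (by omega)]
    ring
end

section
/- Let θ_a, θ_b, θ_c ∈ (0,π) satisfy θ_a + θ_b + θ_c = π. Then −(2πi)^{−2} ∮_{|z| = sin θ_b / sin θ_a} ( ∮_{|w| = sin θ_c / sin θ_a} (1+z+w)^{−1} dw ) dz = sin θ_b · sin θ_c / (π · sin θ_a). Equivalently, writing Ω := (sin θ_c / sin θ_a)·e^{iθ_b}, the left-hand side equals Im(Ω)/π. (This is the evaluation of the speed of growth −K^{-1}_ν(x,n;x+1,n) in Theorem 2.4.) -/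
open MeasureTheory

lemma circleIntegral_inv_add_of_norm_lt {u : ℂ} {r : ℝ} (h : ‖u‖ < r) :
    (∮ w in C(0, r), (u + w)⁻¹) = 2 * (Real.pi : ℂ) * Complex.I := by
  have := circleIntegral.integral_sub_inv_of_mem_ball (c := 0) (w := -u) (R := r) (by simpa using h)
  simpa [add_comm] using this

lemma circleIntegral_inv_add_of_lt_norm {u : ℂ} {r : ℝ} (hr : 0 ≤ r) (h : r < ‖u‖) :
    (∮ w in C(0, r), (u + w)⁻¹) = 0 := by
  have hne : ∀ w ∈ Metric.closedBall (0 : ℂ) r, u + w ≠ 0 := by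
    intro w hw h0
    rw [mem_closedBall_zero_iff] at hw
    rw [eq_neg_of_add_eq_zero_left h0, norm_neg] at h
    linarith
  refine Complex.circleIntegral_eq_zero_of_differentiable_on_off_countable hr
    Set.countable_empty ?_ ?_
  · exact (by fun_prop : ContinuousOn (fun w : ℂ => u + w) _).inv₀ hne
  · intro w hw
    exact (by fun_prop : DifferentiableAt ℂ (fun w : ℂ => u + w) w).inv
      (hne w (Metric.ball_subset_closedBall hw.1))

lemma norm_one_add_circleMap_sq (R t : ℝ) :
    ‖1 + circleMap 0 R t‖ ^ 2 = 1 + R ^ 2 + 2 * R * Real.cos t := by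
  rw [← Complex.normSq_eq_norm_sq, Complex.normSq_apply]
  simp [circleMap, Complex.exp_ofReal_mul_I_re, Complex.exp_ofReal_mul_I_im]
  linear_combination R ^ 2 * Real.sin_sq_add_cos_sq t

lemma cos_eq_neg_cos_abs_sub_pi (t : ℝ) : Real.cos t = -Real.cos |t - Real.pi| := by
  rw [Real.cos_abs, Real.cos_sub_pi, neg_neg]

/-- If `1`, `R`, `r` are the sides of a triangle and `γ` is the angle opposite to `r`, then the
part of the circle `|z| = R` inside `|1 + z| < r` is the arc of half-width `γ` around `-R`. -/
lemma circleIntegral_circleIntegral_inv_one_add_add {R r γ : ℝ} (hR : 0 < R) (hr : 0 < r)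
    (hγ : γ ∈ Set.Ioo 0 Real.pi) (h : r ^ 2 = 1 + R ^ 2 - 2 * R * Real.cos γ) :
    (∮ z in C(0, R), ∮ w in C(0, r), (1 + z + w)⁻¹) = 4 * Real.pi * R * Real.sin γ := by
  have hlt : ∀ t, |t - Real.pi| < γ → ‖1 + circleMap 0 R t‖ < r := by
    intro t htγ
    refine lt_of_pow_lt_pow_left₀ 2 hr.le ?_
    have := Real.cos_lt_cos_of_nonneg_of_le_pi (abs_nonneg _) hγ.2.le htγ
    rw [norm_one_add_circleMap_sq, h, cos_eq_neg_cos_abs_sub_pi t]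
    nlinarith
  have hgt : ∀ t ∈ Set.Ioc 0 (2 * Real.pi), γ < |t - Real.pi| →
      r < ‖1 + circleMap 0 R t‖ := by
    intro t ht htγ
    refine lt_of_pow_lt_pow_left₀ 2 (norm_nonneg _) ?_
    have := Real.cos_lt_cos_of_nonneg_of_le_pi hγ.1.le
      (abs_le.2 ⟨by linarith [ht.1], by linarith [ht.2]⟩) htγ
    rw [norm_one_add_circleMap_sq, h, cos_eq_neg_cos_abs_sub_pi t]
    nlinarith
  have hae : ∀ᵐ t : ℝ, t ∈ Set.Ioc 0 (2 * Real.pi) →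
      deriv (circleMap 0 R) t • (∮ w in C(0, r), (1 + circleMap 0 R t + w)⁻¹) =
        (Set.Ioc (Real.pi - γ) (Real.pi + γ)).indicator
          (fun t => deriv (circleMap 0 R) t * (2 * Real.pi * Complex.I)) t := by
    filter_upwards [Measure.ae_ne volume (Real.pi - γ), Measure.ae_ne volume (Real.pi + γ)]
      with t h1 h2 ht
    by_cases hm : t ∈ Set.Ioc (Real.pi - γ) (Real.pi + γ)
    · have : |t - Real.pi| < γ :=
        abs_lt.2 ⟨by linarith [hm.1], by linarith [lt_of_le_of_ne hm.2 h2]⟩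
      rw [Set.indicator_of_mem hm, circleIntegral_inv_add_of_norm_lt (hlt t this), smul_eq_mul]
    · have : γ < |t - Real.pi| := by
        rw [lt_abs]
        rw [Set.mem_Ioc, not_and_or, not_lt, not_le] at hm
        rcases hm with hm | hm
        · right; linarith [lt_of_le_of_ne hm h1]
        · left; linarith
      rw [Set.indicator_of_notMem hm, circleIntegral_inv_add_of_lt_norm hr.le (hgt t ht this),
        smul_zero]
  have hsub : Set.Ioc (Real.pi - γ) (Real.pi + γ) ⊆ Set.Ioc 0 (2 * Real.pi) :=
    Set.Ioc_subset_Ioc (by linarith [hγ.2]) (by linarith [hγ.2])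
  have hftc : ∫ t in (Real.pi - γ)..(Real.pi + γ), deriv (circleMap 0 R) t =
      circleMap 0 R (Real.pi + γ) - circleMap 0 R (Real.pi - γ) := by
    refine intervalIntegral.integral_deriv_eq_sub
      (fun t _ => (differentiable_circleMap 0 R) t) ?_
    refine Continuous.intervalIntegrable ?_ _ _
    simp only [funext (deriv_circleMap 0 R)]
    fun_prop
  rw [circleIntegral, intervalIntegral.integral_of_le (by positivity),
    setIntegral_congr_ae measurableSet_Ioc hae, setIntegral_indicator measurableSet_Ioc,
    Set.inter_eq_self_of_subset_right hsub,
    ← intervalIntegral.integral_of_le (by linarith [hγ.1]),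
    intervalIntegral.integral_mul_const, hftc]
  have harc : circleMap 0 R (Real.pi + γ) - circleMap 0 R (Real.pi - γ) =
      -(2 * R * Real.sin γ) * Complex.I := by
    simp only [circleMap_zero, Complex.exp_mul_I]
    push_cast
    rw [Complex.cos_add, Complex.cos_sub, Complex.sin_add, Complex.sin_sub, Complex.sin_pi,
      Complex.cos_pi]
    ring
  rw [harc]
  linear_combination (-(4 * Real.pi * R * Real.sin γ) : ℂ) * Complex.I_mul_I

/-- Evaluation of the speed of growth `−K⁻¹_ν(x,n;x+1,n)` (Theorem 2.4):
with `θ_a + θ_b + θ_c = π`, the double contour integral equals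
`sin θ_b sin θ_c / (π sin θ_a) = Im(Ω)/π` where `Ω = (sin θ_c / sin θ_a) e^{iθ_b}`. -/
theorem speed_double_integral (θa θb θc : ℝ)
    (ha : θa ∈ Set.Ioo 0 Real.pi) (hb : θb ∈ Set.Ioo 0 Real.pi)
    (hc : θc ∈ Set.Ioo 0 Real.pi) (hsum : θa + θb + θc = Real.pi) :
    -((2 * (Real.pi : ℂ) * Complex.I) ^ 2)⁻¹ *
      (∮ z in C(0, Real.sin θb / Real.sin θa),
        ∮ w in C(0, Real.sin θc / Real.sin θa), (1 + z + w)⁻¹)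
    = ((Real.sin θb * Real.sin θc / (Real.pi * Real.sin θa) : ℝ) : ℂ) ∧
    Real.sin θb * Real.sin θc / (Real.pi * Real.sin θa) =
      (((Real.sin θc / Real.sin θa : ℝ) : ℂ) *
        Complex.exp (Complex.I * (θb : ℂ))).im / Real.pi := by
  have hsa := Real.sin_pos_of_mem_Ioo ha
  have hsb := Real.sin_pos_of_mem_Ioo hb
  have hsc := Real.sin_pos_of_mem_Ioo hc
  have hpi := Real.pi_ne_zero
  constructor
  · have hsin : Real.sin θa = Real.sin θb * Real.cos θc + Real.cos θb * Real.sin θc := by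
      rw [← Real.sin_add, ← Real.sin_pi_sub θa]
      congr 1
      linarith
    have hcosines : (Real.sin θc / Real.sin θa) ^ 2 =
        1 + (Real.sin θb / Real.sin θa) ^ 2
          - 2 * (Real.sin θb / Real.sin θa) * Real.cos θc := by
      field_simp
      rw [hsin]
      linear_combination (-Real.sin θc ^ 2) * Real.sin_sq_add_cos_sq θb
        + Real.sin θb ^ 2 * Real.sin_sq_add_cos_sq θc
    rw [circleIntegral_circleIntegral_inv_one_add_add (div_pos hsb hsa) (div_pos hsc hsa) hc
      hcosines]
    have hsa' : (Real.sin θa : ℂ) ≠ 0 := by exact_mod_cast hsa.ne'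
    have hpi' : (Real.pi : ℂ) ≠ 0 := by exact_mod_cast hpi
    rw [mul_pow, Complex.I_sq]
    push_cast [-Complex.ofReal_sin]
    field_simp
    norm_num
  · rw [Complex.im_ofReal_mul, mul_comm Complex.I, Complex.exp_ofReal_mul_I_im]
    field_simp
end

section
/- Let a, b, c > 0 satisfy the strict triangle inequalities a < b + c, b < c + a and c < a + b; let θ ∈ (0,π) be defined by cos θ = (a² + c² − b²)/(2ac), and set r := c/a. Then for all integers x, x', n, n' with n ≥ n': (2πi)^{−2} ∮_{|z| = b/a} ( ∮_{|w| = c/a} z^{n−n'} w^{n'−n+x'−x−1} (1+z+w)^{−1} dw ) dz = ((−1)^{n−n'+x−x'}/(2πi)) · ∫_{−θ}^{θ} (r e^{iφ} − 1)^{n−n'} · (r e^{iφ})^{−(n−n'+x−x'+1)} · i r e^{iφ} dφ. (This is the single-integral representation of the infinite-volume inverse Kasteleyn kernel along the arc from the conjugate of Ω := r e^{iθ} to Ω crossing the positive real axis.) -/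
open MeasureTheory

/-- The inverse square root of the distance to a point is locally integrable. -/
lemma intervalIntegrable_abs_sub_rpow_neg_half (p a b : ℝ) :
    IntervalIntegrable (fun x : ℝ => |x - p| ^ (-1 / 2 : ℝ)) volume a b := by
  have key : ∀ a b : ℝ, IntervalIntegrable (fun x : ℝ => |x| ^ (-1 / 2 : ℝ)) volume a b := by
    have h1 : ∀ a b : ℝ, IntervalIntegrable (fun x : ℝ => x ^ (-1 / 2 : ℝ)) volume a b :=
      fun a b => intervalIntegral.intervalIntegrable_rpow' (by norm_num)
    have hpos : ∀ b : ℝ, 0 ≤ b →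
        IntervalIntegrable (fun x : ℝ => |x| ^ (-1 / 2 : ℝ)) volume 0 b := fun b hb =>
      (h1 0 b).congr (fun x hx => by
        rw [Set.uIoc_of_le hb] at hx
        simp only [abs_of_pos hx.1])
    have hall : ∀ b : ℝ, IntervalIntegrable (fun x : ℝ => |x| ^ (-1 / 2 : ℝ)) volume 0 b := by
      intro b
      rcases le_total 0 b with hb | hb
      · exact hpos b hb
      · rw [IntervalIntegrable.iff_comp_neg]
        simpa using hpos (-b) (by linarith)
    exact fun a b => (hall a).symm.trans (hall b)
  simpa using (key (a - p) (b - p)).comp_sub_right p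

/-- Comparison of negative powers, including the degenerate case of the convention `0⁻¹ = 0`. -/
lemma rpow_neg_half_le_of_mul_le {κ A B : ℝ} (hκ : 0 < κ) (hB : 0 ≤ B)
    (hAB : B = 0 → A = 0) (h : κ * B ≤ A) :
    A ^ (-1 / 2 : ℝ) ≤ κ ^ (-1 / 2 : ℝ) * B ^ (-1 / 2 : ℝ) := by
  rcases hB.eq_or_lt with h0 | h0
  · rw [hAB h0.symm, ← h0, Real.zero_rpow (by norm_num)]
    simp
  · rw [← Real.mul_rpow hκ.le hB]
    exact Real.rpow_le_rpow_of_nonpos (by positivity) h (by norm_num)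

lemma exists_mul_abs_sub_le_abs_cos_sub_cos {θ : ℝ} (hθ : θ ∈ Set.Ioo 0 Real.pi) :
    ∃ κ > 0, ∀ α ∈ Set.Icc 0 Real.pi, κ * |α - θ| ≤ |Real.cos α - Real.cos θ| := by
  obtain ⟨α₀, hα₀, hmin⟩ := isCompact_Icc.exists_isMinOn
    (Set.nonempty_Icc.2 Real.pi_pos.le)
    (f := fun α : ℝ => Real.sin ((α + θ) / 2)) (by fun_prop)
  have hm : 0 < Real.sin ((α₀ + θ) / 2) :=
    Real.sin_pos_of_pos_of_lt_pi (by linarith [hα₀.1, hθ.1]) (by linarith [hα₀.2, hθ.2])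
  refine ⟨2 / Real.pi * Real.sin ((α₀ + θ) / 2), by positivity, fun α hα => ?_⟩
  have h1 : Real.sin ((α₀ + θ) / 2) ≤ |Real.sin ((α + θ) / 2)| :=
    (isMinOn_iff.1 hmin α hα).trans (le_abs_self _)
  have h2 : 2 / Real.pi * |(α - θ) / 2| ≤ |Real.sin ((α - θ) / 2)| :=
    Real.mul_abs_le_abs_sin (abs_le.2 ⟨by linarith [hα.1, hθ.2], by linarith [hα.2, hθ.1]⟩)
  rw [Real.cos_sub_cos, abs_mul, abs_mul, abs_neg, abs_two]
  rw [abs_div, abs_two] at h2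
  have h3 := mul_le_mul h1 h2 (by positivity) (abs_nonneg _)
  calc _ = 2 * (Real.sin ((α₀ + θ) / 2) * (2 / Real.pi * (|α - θ| / 2))) := by ring
    _ ≤ _ := by linarith

lemma intervalIntegrable_abs_cos_sub_rpow {q : ℝ} (hq : q ∈ Set.Ioo (-1 : ℝ) 1) :
    IntervalIntegrable (fun α : ℝ => |Real.cos α - q| ^ (-1 / 2 : ℝ)) volume
      0 (2 * Real.pi) := by
  have hθ : Real.arccos q ∈ Set.Ioo 0 Real.pi :=
    ⟨Real.arccos_pos.2 hq.2, (Real.arccos_le_pi q).lt_of_ne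
      fun h => hq.1.not_ge (Real.arccos_eq_pi.1 h)⟩
  obtain ⟨κ, hκ, hle⟩ := exists_mul_abs_sub_le_abs_cos_sub_cos hθ
  rw [Real.cos_arccos hq.1.le hq.2.le] at hle
  have h1 : IntervalIntegrable (fun α : ℝ => |Real.cos α - q| ^ (-1 / 2 : ℝ)) volume
      0 Real.pi := by
    refine ((intervalIntegrable_abs_sub_rpow_neg_half (Real.arccos q) 0 Real.pi).const_mul
      (κ ^ (-1 / 2 : ℝ))).mono_fun (Measurable.aestronglyMeasurable (by fun_prop)) ?_
    rw [Set.uIoc_of_le Real.pi_pos.le]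
    filter_upwards [ae_restrict_mem measurableSet_Ioc] with α hα
    rw [Real.norm_of_nonneg (by positivity), Real.norm_of_nonneg (by positivity)]
    refine rpow_neg_half_le_of_mul_le hκ (abs_nonneg _) (fun h0 => ?_) (hle α ⟨hα.1.le, hα.2⟩)
    rw [sub_eq_zero.1 (abs_eq_zero.1 h0), Real.cos_arccos hq.1.le hq.2.le]
    simp
  refine h1.trans ?_
  have h2 := (h1.comp_sub_left (2 * Real.pi)).symm
  simp only [Real.cos_two_pi_sub, sub_zero] at h2
  rwa [show 2 * Real.pi - Real.pi = Real.pi by ring] at h2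

lemma normSq_one_add_circleMap (s α : ℝ) :
    ‖1 + circleMap 0 s α‖ ^ 2 = 1 + s ^ 2 + 2 * s * Real.cos α := by
  rw [← Complex.normSq_eq_norm_sq, Complex.normSq_apply]
  simp only [Complex.add_re, Complex.add_im, circleMap_zero_re, circleMap_zero_im,
    Complex.one_re, Complex.one_im]
  linear_combination s ^ 2 * Real.sin_sq_add_cos_sq α

lemma intervalIntegrable_abs_norm_one_add_circleMap_sub_rpow {s t : ℝ} (hs : 0 < s) (ht : 0 < t)
    (h1 : 1 < s + t) (h2 : s < 1 + t) (h3 : t < 1 + s) :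
    IntervalIntegrable (fun α : ℝ => |‖1 + circleMap 0 s α‖ - t| ^ (-1 / 2 : ℝ)) volume
      0 (2 * Real.pi) := by
  set q : ℝ := (t ^ 2 - 1 - s ^ 2) / (2 * s) with hqdef
  have hq : q ∈ Set.Ioo (-1 : ℝ) 1 := by
    constructor
    · rw [hqdef, lt_div_iff₀ (by positivity)]; nlinarith
    · rw [hqdef, div_lt_iff₀ (by positivity)]; nlinarith
  have hκ : 0 < 2 * s / (1 + s + t) := by positivity
  have hcont : Continuous (circleMap 0 s) := continuous_circleMap 0 s
  refine ((intervalIntegrable_abs_cos_sub_rpow hq).const_mul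
    ((2 * s / (1 + s + t)) ^ (-1 / 2 : ℝ))).mono_fun
      (Measurable.aestronglyMeasurable (by have := hcont.measurable; fun_prop)) ?_
  refine Filter.Eventually.of_forall fun α => ?_
  simp only
  rw [Real.norm_of_nonneg (by positivity), Real.norm_of_nonneg (by positivity)]
  have hsq := normSq_one_add_circleMap s α
  have heq : (‖1 + circleMap 0 s α‖ - t) * (‖1 + circleMap 0 s α‖ + t)
      = 2 * s * (Real.cos α - q) := by
    have : 2 * s * q = t ^ 2 - 1 - s ^ 2 := by rw [hqdef]; field_simp
    linear_combination hsq + this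
  have hpos : 0 < ‖1 + circleMap 0 s α‖ + t := by positivity
  have habs := congrArg abs heq
  rw [abs_mul, abs_mul, abs_of_pos hpos, abs_of_pos (by positivity : 0 < 2 * s)] at habs
  refine rpow_neg_half_le_of_mul_le hκ (abs_nonneg _) (fun h0 => ?_) ?_
  · rw [h0, mul_zero] at habs
    exact (mul_eq_zero.1 habs).resolve_right hpos.ne'
  · have hle : ‖1 + circleMap 0 s α‖ + t ≤ 1 + s + t := by
      have := norm_add_le (1 : ℂ) (circleMap 0 s α)
      rw [norm_one, norm_circleMap_zero, abs_of_pos hs] at this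
      linarith
    rw [div_mul_eq_mul_div, div_le_iff₀ (by positivity), ← habs]
    gcongr

lemma ae_cos_ne (q : ℝ) : ∀ᵐ α : ℝ, Real.cos α ≠ q := by
  have : {α : ℝ | Real.cos α = q}.Countable := by
    rcases Set.eq_empty_or_nonempty {α : ℝ | Real.cos α = q} with h | ⟨x, hx⟩
    · simp [h]
    · refine ((Set.countable_range fun k : ℤ => 2 * (k : ℝ) * Real.pi + x).union
        (Set.countable_range fun k : ℤ => 2 * (k : ℝ) * Real.pi - x)).mono fun y hy => ?_
      obtain ⟨k, hk | hk⟩ := Real.cos_eq_cos_iff.1 ((hx : Real.cos x = q).trans hy.symm)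
      · exact Or.inl ⟨k, hk.symm⟩
      · exact Or.inr ⟨k, hk.symm⟩
  simpa using this.ae_notMem volume

lemma ae_norm_one_add_circleMap_ne {s : ℝ} (hs : s ≠ 0) (t : ℝ) :
    ∀ᵐ α : ℝ, ‖1 + circleMap 0 s α‖ ≠ t := by
  filter_upwards [ae_cos_ne ((t ^ 2 - 1 - s ^ 2) / (2 * s))] with α hα h
  refine hα ?_
  rw [eq_div_iff (by positivity)]
  have := normSq_one_add_circleMap s α
  rw [h] at this
  linear_combination -this

lemma abs_norm_sub_le_norm_add (u v : ℂ) : |‖u‖ - ‖v‖| ≤ ‖u + v‖ := by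
  simpa using abs_norm_sub_norm_le u (-v)

lemma integrable_inv_one_add_circleMap_add_circleMap {s t : ℝ} (hs : 0 < s) (ht : 0 < t)
    (h1 : 1 < s + t) (h2 : s < 1 + t) (h3 : t < 1 + s) :
    Integrable (fun p : ℝ × ℝ => (1 + circleMap 0 s p.1 + circleMap 0 t p.2)⁻¹)
      ((volume.restrict (Set.uIoc 0 (2 * Real.pi))).prod
        (volume.restrict (Set.uIoc 0 (2 * Real.pi)))) := by
  have hs' := (intervalIntegrable_abs_norm_one_add_circleMap_sub_rpow hs ht h1 h2 h3).def'
  have ht' := (intervalIntegrable_abs_norm_one_add_circleMap_sub_rpow ht hs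
    (by linarith) h3 h2).def'
  have hcs : Continuous (circleMap 0 s) := continuous_circleMap 0 s
  have hct : Continuous (circleMap 0 t) := continuous_circleMap 0 t
  have hmeas : Measurable
      (fun p : ℝ × ℝ => (1 + circleMap 0 s p.1 + circleMap 0 t p.2)⁻¹) :=
    Measurable.inv (Continuous.measurable (by fun_prop))
  refine (hs'.mul_prod ht').mono hmeas.aestronglyMeasurable ?_
  filter_upwards [Measure.quasiMeasurePreserving_fst.ae
      (ae_restrict_of_ae (ae_norm_one_add_circleMap_ne hs.ne' t)),
    Measure.quasiMeasurePreserving_snd.ae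
      (ae_restrict_of_ae (ae_norm_one_add_circleMap_ne ht.ne' s))] with p hp1 hp2
  set A := |‖1 + circleMap 0 s p.1‖ - t|
  set B := |‖1 + circleMap 0 t p.2‖ - s|
  have hA : 0 < A := abs_pos.2 (sub_ne_zero.2 hp1)
  have hB : 0 < B := abs_pos.2 (sub_ne_zero.2 hp2)
  have hAD : A ≤ ‖1 + circleMap 0 s p.1 + circleMap 0 t p.2‖ := by
    have := abs_norm_sub_le_norm_add (1 + circleMap 0 s p.1) (circleMap 0 t p.2)
    rwa [norm_circleMap_zero, abs_of_pos ht] at this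
  have hBD : B ≤ ‖1 + circleMap 0 s p.1 + circleMap 0 t p.2‖ := by
    have := abs_norm_sub_le_norm_add (1 + circleMap 0 t p.2) (circleMap 0 s p.1)
    rwa [norm_circleMap_zero, abs_of_pos hs, add_right_comm] at this
  set D := ‖1 + circleMap 0 s p.1 + circleMap 0 t p.2‖
  have hD : 0 < D := hA.trans_le hAD
  rw [norm_inv, Real.norm_of_nonneg (by positivity)]
  calc D⁻¹ = D ^ (-1 / 2 : ℝ) * D ^ (-1 / 2 : ℝ) := by
        rw [← Real.rpow_add hD, ← Real.rpow_neg_one]; norm_num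
    _ ≤ A ^ (-1 / 2 : ℝ) * B ^ (-1 / 2 : ℝ) :=
        mul_le_mul (Real.rpow_le_rpow_of_nonpos hA hAD (by norm_num))
          (Real.rpow_le_rpow_of_nonpos hB hBD (by norm_num)) (by positivity) (by positivity)

lemma circleIntegral_circleIntegral_swap {s t : ℝ} (hs : 0 < s) (ht : 0 < t)
    (h1 : 1 < s + t) (h2 : s < 1 + t) (h3 : t < 1 + s) (m k : ℤ) :
    (∮ z in C(0, s), ∮ w in C(0, t), z ^ m * w ^ k * (1 + z + w)⁻¹)
      = ∮ w in C(0, t), w ^ k * ∮ z in C(0, s), z ^ m * (1 + z + w)⁻¹ := by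
  simp only [circleIntegral, deriv_circleMap, smul_eq_mul]
  simp only [← intervalIntegral.integral_const_mul]
  simp only [intervalIntegral.integral_of_le Real.two_pi_pos.le]
  rw [integral_integral_swap]
  · refine integral_congr_ae (.of_forall fun β => integral_congr_ae (.of_forall fun α => ?_))
    simp only
    ring
  · have hcs : Continuous (circleMap 0 s) := continuous_circleMap 0 s
    have hct : Continuous (circleMap 0 t) := continuous_circleMap 0 t
    have hmeas : Measurable (fun p : ℝ × ℝ => circleMap 0 s p.1 * Complex.I *
        (circleMap 0 t p.2 * Complex.I) * (circleMap 0 s p.1 ^ m * circleMap 0 t p.2 ^ k)) := by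
      have := hcs.measurable
      have := hct.measurable
      fun_prop
    have hint := integrable_inv_one_add_circleMap_add_circleMap hs ht h1 h2 h3
    rw [Set.uIoc_of_le Real.two_pi_pos.le] at hint
    refine (hint.bdd_mul
      (c := s * t * (s ^ m * t ^ k)) hmeas.aestronglyMeasurable
      (Filter.Eventually.of_forall fun p => ?_)).congr
      (Filter.Eventually.of_forall fun p => ?_)
    · simp [abs_of_pos hs, abs_of_pos ht]
    · simp only [Function.uncurry]
      ring

lemma circleIntegral_pow_mul_inv_of_norm_lt {s : ℝ} {w : ℂ} (m : ℕ) (hw : ‖1 + w‖ < s) :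
    (∮ z in C(0, s), z ^ m * (1 + z + w)⁻¹) = 2 * Real.pi * Complex.I * (-(1 + w)) ^ m := by
  have hd : DiffContOnCl ℂ (fun z : ℂ => z ^ m) (Metric.ball 0 s) :=
    Differentiable.diffContOnCl (by fun_prop)
  have := hd.circleIntegral_sub_inv_smul (w := -(1 + w)) (by rwa [mem_ball_zero_iff, norm_neg])
  rw [smul_eq_mul] at this
  rw [← this]
  congr 1
  ext z
  rw [smul_eq_mul, mul_comm]
  congr 2
  ring

lemma circleIntegral_pow_mul_inv_of_lt_norm {s : ℝ} {w : ℂ} (m : ℕ) (hs : 0 < s)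
    (hw : s < ‖1 + w‖) : (∮ z in C(0, s), z ^ m * (1 + z + w)⁻¹) = 0 := by
  have hne : ∀ z ∈ Metric.closedBall (0 : ℂ) s, 1 + z + w ≠ 0 := fun z hz h0 => by
    have h1 : ‖z‖ ≤ s := by simpa using hz
    have h2 : z = -(1 + w) := by linear_combination h0
    rw [h2, norm_neg] at h1
    linarith
  refine DiffContOnCl.circleIntegral_eq_zero hs.le (DifferentiableOn.diffContOnCl ?_)
  rw [closure_ball _ hs.ne']
  intro z hz
  have := hne z hz
  exact DifferentiableAt.differentiableWithinAt (by fun_prop (disch := assumption))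

lemma circleMap_add_pi (r φ : ℝ) :
    circleMap 0 r (φ + Real.pi) = -((r : ℂ) * Complex.exp (Complex.I * φ)) := by
  rw [circleMap_zero]
  push_cast
  rw [add_mul, Complex.exp_add, Complex.exp_pi_mul_I, mul_comm Complex.I]
  ring

/-- The contour integral with values supported on an arc around `-r`, parametrised by the
angle measured from the negative axis. -/
lemma circleIntegral_eq_integral_arc {r θ : ℝ} (hθ : θ ∈ Set.Ioo 0 Real.pi) {f g : ℂ → ℂ}
    (hin : ∀ φ ∈ Set.Ioo (-θ) θ, f (circleMap 0 r (φ + Real.pi)) = g (circleMap 0 r (φ + Real.pi)))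
    (hout : ∀ φ ∈ Set.Icc (-Real.pi) Real.pi, θ < |φ| → f (circleMap 0 r (φ + Real.pi)) = 0) :
    (∮ w in C(0, r), f w) = ∫ φ in (-θ)..θ, circleMap 0 r (φ + Real.pi) * Complex.I *
      g (circleMap 0 r (φ + Real.pi)) := by
  obtain ⟨h0, hπ⟩ := hθ
  simp only [circleIntegral, deriv_circleMap, smul_eq_mul]
  have hshift := intervalIntegral.integral_comp_add_right (a := -Real.pi) (b := Real.pi)
    (fun φ => circleMap 0 r φ * Complex.I * f (circleMap 0 r φ)) Real.pi
  rw [neg_add_cancel, ← two_mul] at hshift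
  rw [← hshift, intervalIntegral.integral_of_le (by linarith),
    intervalIntegral.integral_of_le (by linarith), ← integral_Icc_eq_integral_Ioc]
  have hcongr : Set.EqOn
      (fun φ => circleMap 0 r (φ + Real.pi) * Complex.I * g (circleMap 0 r (φ + Real.pi)))
      (fun φ => circleMap 0 r (φ + Real.pi) * Complex.I * f (circleMap 0 r (φ + Real.pi)))
      (Set.Ioo (-θ) θ) := fun φ hφ => by simp only [hin φ hφ]
  rw [integral_Ioc_eq_integral_Ioo, setIntegral_congr_fun measurableSet_Ioo hcongr,
    ← integral_Icc_eq_integral_Ioo]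
  refine setIntegral_eq_of_subset_of_forall_sdiff_eq_zero measurableSet_Icc
    (Set.Icc_subset_Icc (by linarith) hπ.le) fun φ hφ => ?_
  rw [hout φ hφ.1 (not_le.1 fun h => hφ.2 (abs_le.1 h)), mul_zero]

/-- Single-integral representation of the infinite-volume inverse Kasteleyn kernel,
case `n ≥ n'`: integration along the arc from `conj Ω` to `Ω := (c/a)e^{iθ}`
crossing the positive real axis. -/
theorem kernel_single_integral_pos (a b c : ℝ)
    (ha : 0 < a) (hb : 0 < b) (hc : 0 < c)
    (habc : a < b + c) (hbca : b < c + a) (hcab : c < a + b)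
    (θ : ℝ) (hθ : θ ∈ Set.Ioo 0 Real.pi)
    (hcos : Real.cos θ = (a ^ 2 + c ^ 2 - b ^ 2) / (2 * a * c))
    (x x' n n' : ℤ) (h : n' ≤ n) :
    ((2 * (Real.pi : ℂ) * Complex.I) ^ 2)⁻¹ *
      (∮ z in C(0, b / a), ∮ w in C(0, c / a),
        z ^ (n - n') * w ^ (n' - n + x' - x - 1) * (1 + z + w)⁻¹)
    = ((-1 : ℂ) ^ (n - n' + x - x') / (2 * (Real.pi : ℂ) * Complex.I)) *
      ∫ φ in (-θ)..θ,
        (((c / a : ℝ) : ℂ) * Complex.exp (Complex.I * (φ : ℂ)) - 1) ^ (n - n') *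
          (((c / a : ℝ) : ℂ) * Complex.exp (Complex.I * (φ : ℂ)))
            ^ (-(n - n' + x - x' + 1)) *
          (Complex.I * (((c / a : ℝ) : ℂ) * Complex.exp (Complex.I * (φ : ℂ)))) := by
  obtain ⟨m, hm⟩ := Int.eq_ofNat_of_zero_le (sub_nonneg.2 h)
  have hr : 0 < c / a := div_pos hc ha
  have hR : 0 < b / a := div_pos hb ha
  have hcos' : (b / a) ^ 2 = 1 + (c / a) ^ 2 - 2 * (c / a) * Real.cos θ := by
    rw [hcos]; field_simp; ring
  have h1 : 1 < b / a + c / a := by rw [← add_div, lt_div_iff₀ ha]; linarith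
  have h2 : b / a < 1 + c / a := by rw [← sub_lt_iff_lt_add, ← sub_div, div_lt_one ha]; linarith
  have h3 : c / a < 1 + b / a := by rw [← sub_lt_iff_lt_add, ← sub_div, div_lt_one ha]; linarith
  set r := c / a
  set R := b / a
  have hnorm : ∀ φ : ℝ, ‖1 + circleMap 0 r (φ + Real.pi)‖ ^ 2
      = 1 + r ^ 2 - 2 * r * Real.cos φ := fun φ => by
    rw [normSq_one_add_circleMap, Real.cos_add_pi]; ring
  rw [circleIntegral_circleIntegral_swap hR hr h1 h2 h3, hm,
    circleIntegral_eq_integral_arc hθ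
      (g := fun w => w ^ (n' - n + x' - x - 1) * (2 * Real.pi * Complex.I * (-(1 + w)) ^ m))]
  · simp only [circleMap_add_pi]
    rw [← intervalIntegral.integral_const_mul, ← intervalIntegral.integral_const_mul]
    refine intervalIntegral.integral_congr fun φ _ => ?_
    set w : ℂ := (r : ℂ) * Complex.exp (Complex.I * φ)
    have hk : n' - n + x' - x - 1 = -((m : ℤ) + x - x' + 1) := by rw [← hm]; ring
    have hsign : (-1 : ℂ) ^ (-((m : ℤ) + x - x' + 1)) = -(-1 : ℂ) ^ ((m : ℤ) + x - x') := by
      rw [zpow_neg, ← inv_zpow, inv_neg, inv_one, zpow_add_one₀ (by norm_num)]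
      ring
    have hpow : (-w) ^ (-((m : ℤ) + x - x' + 1))
        = -(-1 : ℂ) ^ ((m : ℤ) + x - x') * w ^ (-((m : ℤ) + x - x' + 1)) := by
      rw [← hsign, ← mul_zpow, neg_one_mul]
    rw [hk, hpow, zpow_natCast]
    have hb' : -(1 + -w) = w - 1 := by ring
    rw [hb']
    have := Complex.two_pi_I_ne_zero
    field_simp
  · intro φ hφ
    simp only [zpow_natCast]
    rw [circleIntegral_pow_mul_inv_of_norm_lt]
    refine lt_of_pow_lt_pow_left₀ 2 hR.le ?_
    have : Real.cos θ < Real.cos φ := by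
      rw [← Real.cos_abs φ]
      exact Real.cos_lt_cos_of_nonneg_of_le_pi (abs_nonneg φ) hθ.2.le (abs_lt.2 hφ)
    rw [hnorm, hcos']
    nlinarith
  · intro φ hφ hlt
    simp only [zpow_natCast]
    rw [circleIntegral_pow_mul_inv_of_lt_norm m hR, mul_zero]
    refine lt_of_pow_lt_pow_left₀ 2 (norm_nonneg _) ?_
    have : Real.cos φ < Real.cos θ := by
      rw [← Real.cos_abs φ]
      exact Real.cos_lt_cos_of_nonneg_of_le_pi hθ.1.le (abs_le.2 hφ) hlt
    rw [hnorm, hcos']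
    nlinarith
end

section
/- Let a, b, c > 0 satisfy the strict triangle inequalities a < b + c, b < c + a and c < a + b; let θ ∈ (0,π) be defined by cos θ = (a² + c² − b²)/(2ac), and set r := c/a. Then for all integers x, x', n, n' with n < n': (2πi)^{−2} ∮_{|z| = b/a} ( ∮_{|w| = c/a} z^{n−n'} w^{n'−n+x'−x−1} (1+z+w)^{−1} dw ) dz = ((−1)^{n−n'+x−x'}/(2πi)) · ∫_{−θ}^{θ−2π} (r e^{iφ} − 1)^{n−n'} · (r e^{iφ})^{−(n−n'+x−x'+1)} · i r e^{iφ} dφ. (This is the single-integral representation of the infinite-volume inverse Kasteleyn kernel along the arc from the conjugate of Ω := r e^{iθ} to Ω crossing the negative real axis.) -/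
open MeasureTheory

section

open Filter Topology Complex Real

theorem integrableAtFilter_inv_norm_sub {E : Type*} [NormedAddCommGroup E] [NormedSpace ℝ E]
    [FiniteDimensional ℝ E] [MeasurableSpace E] [BorelSpace E] (μ : Measure E) [μ.IsAddHaarMeasure]
    (hE : 1 < Module.finrank ℝ E) (p : E) :
    IntegrableAtFilter (fun q ↦ ‖q - p‖⁻¹) (𝓝 p) μ := by
  have := Module.nontrivial_of_finrank_pos (R := ℝ) (M := E) (by omega)
  have h0 : IntegrableOn (fun q : E ↦ ‖q‖⁻¹) (Metric.ball 0 1) μ := by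
    rw [integrableOn_fun_norm_addHaar μ (f := fun y ↦ y⁻¹)]
    have hc : IntegrableOn (fun y : ℝ ↦ y ^ (Module.finrank ℝ E - 2)) (Set.Ioo 0 1) :=
      ((continuous_pow _).continuousOn.integrableOn_compact
        (isCompact_Icc (a := (0 : ℝ)) (b := 1))).mono_set Set.Ioo_subset_Icc_self
    refine hc.congr_fun (fun y hy ↦ ?_) measurableSet_Ioo
    have : Module.finrank ℝ E - 1 = (Module.finrank ℝ E - 2) + 1 := by omega
    have hy0 : y ≠ 0 := hy.1.ne'
    simp only [this, smul_eq_mul, pow_succ]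
    field_simp
  refine ⟨Metric.ball p 1, Metric.ball_mem_nhds p one_pos, ?_⟩
  have := (measurePreserving_sub_right μ p).integrableOn_comp_preimage
    (MeasurableEquiv.subRight p).measurableEmbedding (f := fun q : E ↦ ‖q‖⁻¹)
    (s := Metric.ball 0 1)
  have h1 := this.2 h0
  have h2 : (fun x ↦ x - p) ⁻¹' Metric.ball 0 1 = Metric.ball p 1 := by
    ext q
    simp [dist_eq_norm]
  exact h2 ▸ h1

theorem integrableAtFilter_inv_of_hasFDerivAt {E : Type*} [NormedAddCommGroup E] [NormedSpace ℝ E]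
    [FiniteDimensional ℝ E] [MeasurableSpace E] [BorelSpace E] (μ : Measure E) [μ.IsAddHaarMeasure]
    (hE : 1 < Module.finrank ℝ E) {f : E → ℂ} (hf : Measurable f) {L : E →L[ℝ] ℂ} {p : E}
    (hp : f p = 0) (hL : HasFDerivAt f L p) (hker : ∀ v, L v = 0 → v = 0) :
    IntegrableAtFilter (fun q ↦ (f q)⁻¹) (𝓝 p) μ := by
  obtain ⟨K, -, hK⟩ := LinearMap.exists_antilipschitzWith (L : E →ₗ[ℝ] ℂ)
    (LinearMap.ker_eq_bot'.2 hker)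
  have h1 : (fun q ↦ q - p) =O[𝓝 p] fun q ↦ L (q - p) :=
    Asymptotics.IsBigO.of_bound K (Eventually.of_forall fun q ↦ hK.le_mul_norm (map_zero L) (q - p))
  have h2 : (fun q ↦ q - p) =O[𝓝 p] f := by
    have h3 := h1.trans (hL.isLittleO.trans_isBigO h1).right_isBigO_add
    simpa [hp] using! h3
  refine (h2.norm_left.inv_rev ?_).integrableAtFilter
    (hf.inv.aestronglyMeasurable.stronglyMeasurableAtFilter)
    (integrableAtFilter_inv_norm_sub μ hE p)
  refine Eventually.of_forall fun q hq ↦ ?_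
  rw [norm_eq_zero, sub_eq_zero] at hq
  rw [hq, hp]

theorem eq_zero_of_real_combination_eq_zero {ρ r : ℝ} (hρ : 0 < ρ) (hr : 0 < r)
    (h1 : 1 < ρ + r) (h2 : ρ < 1 + r) (h3 : r < 1 + ρ) {z w : ℂ} (hz : ‖z‖ = ρ) (hw : ‖w‖ = r)
    (hzw : 1 + z + w = 0) {s t : ℝ} (hst : s * z + t * w = 0) : s = 0 ∧ t = 0 := by
  have hz' : z.re ^ 2 + z.im ^ 2 = ρ ^ 2 := by
    rw [← hz, Complex.sq_norm, Complex.normSq_apply]; ring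
  have hw' : w.re ^ 2 + w.im ^ 2 = r ^ 2 := by
    rw [← hw, Complex.sq_norm, Complex.normSq_apply]; ring
  have hre : w.re = -1 - z.re := by
    have := congrArg Complex.re hzw
    simp at this; linarith
  have him : w.im = -z.im := by
    have := congrArg Complex.im hzw
    simp at this; linarith
  have e1 := congrArg Complex.re hst
  have e2 := congrArg Complex.im hst
  simp only [add_re, re_ofReal_mul, zero_re, add_im, im_ofReal_mul, zero_im] at e1 e2
  rw [hre] at e1 hw'
  rw [him] at e2 hw'
  have him0 : z.im ≠ 0 := by
    intro h0
    rw [h0] at hz' hw'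
    have a1 : z.re = ρ ∨ z.re = -ρ := sq_eq_sq_iff_eq_or_eq_neg.1 (by linarith)
    have a2 : -1 - z.re = r ∨ -1 - z.re = -r := sq_eq_sq_iff_eq_or_eq_neg.1 (by linarith)
    rcases a1 with a1 | a1 <;> rcases a2 with a2 | a2 <;> linarith
  have hs : s = t := by
    have : (s - t) * z.im = 0 := by linarith
    rcases mul_eq_zero.1 this with h | h
    · linarith
    · exact absurd h him0
  subst hs
  have : s = 0 := by linarith
  exact ⟨this, this⟩

theorem locallyIntegrable_inv_one_add_circleMap {ρ r : ℝ} (hρ : 0 < ρ) (hr : 0 < r)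
    (h1 : 1 < ρ + r) (h2 : ρ < 1 + r) (h3 : r < 1 + ρ) :
    LocallyIntegrable (fun q : ℝ × ℝ ↦ (1 + circleMap 0 ρ q.1 + circleMap 0 r q.2)⁻¹) := by
  have hcont : Continuous fun q : ℝ × ℝ ↦ 1 + circleMap 0 ρ q.1 + circleMap 0 r q.2 := by
    fun_prop
  intro p
  by_cases hp : 1 + circleMap 0 ρ p.1 + circleMap 0 r p.2 = 0
  · have d1 := (hasDerivAt_circleMap 0 ρ p.1).hasFDerivAt.comp p
      (hasFDerivAt_fst (𝕜 := ℝ) (E := ℝ) (F := ℝ))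
    have d2 := (hasDerivAt_circleMap 0 r p.2).hasFDerivAt.comp p
      (hasFDerivAt_snd (𝕜 := ℝ) (E := ℝ) (F := ℝ))
    refine integrableAtFilter_inv_of_hasFDerivAt volume (by simp) hcont.measurable hp
      ((d1.const_add 1).add d2) fun v hv ↦ ?_
    have hv' : ((v.1 : ℂ) * circleMap 0 ρ p.1 + v.2 * circleMap 0 r p.2) * I = 0 := by
      refine Eq.trans ?_ hv
      simp
      ring
    obtain ⟨s, t⟩ := eq_zero_of_real_combination_eq_zero hρ hr h1 h2 h3
      (by rw [norm_circleMap_zero, abs_of_pos hρ]) (by rw [norm_circleMap_zero, abs_of_pos hr])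
      hp (by simpa using hv')
    exact Prod.ext s t
  · exact (hcont.continuousAt.inv₀ hp).integrableAtFilter
      (hcont.measurable.inv.aestronglyMeasurable.stronglyMeasurableAtFilter) (volume.finiteAt_nhds p)

theorem circleIntegral_swap {ρ r : ℝ} (hρ : 0 < ρ) (hr : 0 < r)
    (h1 : 1 < ρ + r) (h2 : ρ < 1 + r) (h3 : r < 1 + ρ) (m k : ℤ) :
    (∮ z in C(0, ρ), ∮ w in C(0, r), z ^ m * w ^ k * (1 + z + w)⁻¹) =
      ∮ w in C(0, r), ∮ z in C(0, ρ), z ^ m * w ^ k * (1 + z + w)⁻¹ := by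
  simp only [circleIntegral, ← intervalIntegral.integral_smul]
  rw [intervalIntegral_intervalIntegral_swap]
  · simp only [smul_comm (deriv (circleMap 0 ρ) _)]
  · have hK : IsCompact (Set.uIcc 0 (2 * π) ×ˢ Set.uIcc 0 (2 * π)) :=
      isCompact_uIcc.prod isCompact_uIcc
    have hint := (locallyIntegrable_inv_one_add_circleMap hρ hr h1 h2 h3).integrableOn_isCompact hK
    have hz : Continuous fun q : ℝ × ℝ ↦ circleMap 0 ρ q.1 ^ m :=
      (by fun_prop : Continuous fun q : ℝ × ℝ ↦ circleMap 0 ρ q.1).zpow₀ m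
        fun q ↦ Or.inl (circleMap_ne_center hρ.ne')
    have hw : Continuous fun q : ℝ × ℝ ↦ circleMap 0 r q.2 ^ k :=
      (by fun_prop : Continuous fun q : ℝ × ℝ ↦ circleMap 0 r q.2).zpow₀ k
        fun q ↦ Or.inl (circleMap_ne_center hr.ne')
    have hg : Continuous fun q : ℝ × ℝ ↦ circleMap 0 ρ q.1 * I * (circleMap 0 r q.2 * I) *
        (circleMap 0 ρ q.1 ^ m * circleMap 0 r q.2 ^ k) := by fun_prop
    refine ((hint.continuousOn_mul hg.continuousOn hK).mono_set
      (Set.prod_mono Set.uIoc_subset_uIcc Set.uIoc_subset_uIcc)).congr_fun (fun q _ ↦ ?_)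
      (measurableSet_uIoc.prod measurableSet_uIoc)
    simp only [Function.uncurry, deriv_circleMap, smul_eq_mul]
    ring

theorem circleIntegral_inv_pow_mul_inv_sub {ρ : ℝ} (hρ : 0 < ρ) {s : ℂ} (hs0 : s ≠ 0)
    (hs : ‖s‖ ≠ ρ) (m : ℕ) :
    (∮ z in C(0, ρ), (z ^ (m + 1))⁻¹ * (z - s)⁻¹) =
      (s ^ (m + 1))⁻¹ * ((∮ z in C(0, ρ), (z - s)⁻¹) - 2 * π * I) := by
  have hz0 : ∀ z ∈ Metric.sphere (0 : ℂ) ρ, z ≠ 0 := fun z hz ↦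
    ne_zero_of_mem_sphere hρ.ne' ⟨z, hz⟩
  have hzs : ∀ z ∈ Metric.sphere (0 : ℂ) ρ, z - s ≠ 0 := fun z hz h ↦ hs (by
    rw [← sub_eq_zero.1 h]; simpa using hz)
  have hi1 (j : ℕ) : CircleIntegrable (fun z ↦ (z ^ j)⁻¹ * (z - s)⁻¹) 0 ρ :=
    ContinuousOn.circleIntegrable hρ.le <|
      ((continuousOn_id.pow j).inv₀ fun z hz ↦ pow_ne_zero _ (hz0 z hz)).mul
        ((continuousOn_id.sub continuousOn_const).inv₀ hzs)
  have hi2 (j : ℕ) : CircleIntegrable (fun z ↦ (z ^ j)⁻¹) 0 ρ :=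
    ContinuousOn.circleIntegrable hρ.le <|
      (continuousOn_id.pow j).inv₀ fun z hz ↦ pow_ne_zero _ (hz0 z hz)
  have step (j : ℕ) : (∮ z in C(0, ρ), (z ^ (j + 1))⁻¹ * (z - s)⁻¹) =
      s⁻¹ * ((∮ z in C(0, ρ), (z ^ j)⁻¹ * (z - s)⁻¹) - ∮ z in C(0, ρ), (z ^ (j + 1))⁻¹) := by
    rw [← circleIntegral.integral_sub (hi1 j) (hi2 (j + 1)),
      ← circleIntegral.integral_const_mul]
    refine circleIntegral.integral_congr hρ.le fun z hz ↦ ?_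
    have := hz0 z hz
    have := hzs z hz
    simp only [pow_succ]
    field_simp
    ring
  induction m with
  | zero =>
    rw [step 0]
    have := circleIntegral.integral_sub_inv_of_mem_ball (c := 0) (w := 0) (R := ρ) (by simpa)
    simp only [sub_zero] at this
    simp [this]
  | succ m ih =>
    have hzero : (∮ z in C(0, ρ), (z ^ (m + 1 + 1))⁻¹) = 0 := by
      have := circleIntegral.integral_sub_zpow_of_ne (n := -((m + 1 + 1 : ℕ) : ℤ)) (by push_cast; omega)
        0 0 ρ
      simpa only [sub_zero, zpow_neg, zpow_natCast] using this
    rw [step (m + 1), ih, hzero, pow_succ s (m + 1), mul_inv]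
    ring

theorem circleIntegral_inv_pow_mul_inv_sub_of_lt {ρ : ℝ} {s : ℂ} (hs : ‖s‖ < ρ) (m : ℕ) :
    (∮ z in C(0, ρ), (z ^ (m + 1))⁻¹ * (z - s)⁻¹) = 0 := by
  rcases eq_or_ne s 0 with rfl | hs0
  · have := circleIntegral.integral_sub_zpow_of_ne (n := -((m + 2 : ℕ) : ℤ)) (by push_cast; omega)
        0 0 ρ
    simpa only [sub_zero, zpow_neg, zpow_natCast, pow_succ, mul_inv] using this
  · rw [circleIntegral_inv_pow_mul_inv_sub ((norm_nonneg s).trans_lt hs) hs0 hs.ne,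
      circleIntegral.integral_sub_inv_of_mem_ball (by simpa), sub_self, mul_zero]

theorem circleIntegral_inv_pow_mul_inv_sub_of_gt {ρ : ℝ} (hρ : 0 < ρ) {s : ℂ} (hs : ρ < ‖s‖)
    (m : ℕ) :
    (∮ z in C(0, ρ), (z ^ (m + 1))⁻¹ * (z - s)⁻¹) = -(2 * π * I) * (s ^ (m + 1))⁻¹ := by
  have hzs : ∀ z ∈ Metric.closedBall (0 : ℂ) ρ, z - s ≠ 0 := fun z hz h ↦ by
    rw [sub_eq_zero.1 h, mem_closedBall_zero_iff] at hz
    linarith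
  have h0 : (∮ z in C(0, ρ), (z - s)⁻¹) = 0 :=
    circleIntegral_eq_zero_of_differentiable_on_off_countable hρ.le Set.countable_empty
      ((continuousOn_id.sub continuousOn_const).inv₀ hzs)
      fun z hz ↦ ((differentiableAt_id.sub_const s).inv
        (hzs z (Metric.ball_subset_closedBall hz.1)))
  rw [circleIntegral_inv_pow_mul_inv_sub hρ (norm_pos_iff.1 (hρ.trans hs)) hs.ne', h0]
  ring

theorem norm_real_mul_exp_sub_one_sq (r φ : ℝ) :
    ‖(r : ℂ) * Complex.exp (I * φ) - 1‖ ^ 2 = r ^ 2 + 1 - 2 * r * Real.cos φ := by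
  rw [mul_comm I, Complex.exp_mul_I, ← Complex.ofReal_cos, ← Complex.ofReal_sin, Complex.sq_norm,
    Complex.normSq_apply]
  simp only [sub_re, sub_im, re_ofReal_mul, im_ofReal_mul, add_re, add_im, mul_I_re, mul_I_im,
    ofReal_re, ofReal_im, one_re, one_im]
  linear_combination r ^ 2 * Real.sin_sq_add_cos_sq φ

theorem cos_lt_cos_of_abs_lt {θ φ : ℝ} (hθ : θ ≤ π) (hφ : |φ| < θ) :
    Real.cos θ < Real.cos φ := by
  rw [← Real.cos_abs φ]
  exact Real.cos_lt_cos_of_nonneg_of_le_pi (abs_nonneg φ) hθ hφ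

theorem circleIntegral_inner_eq_zero {ρ : ℝ} {u : ℂ} (hu : ‖u - 1‖ < ρ)
    {m : ℤ} (hm : m < 0) (k : ℤ) :
    (∮ z in C(0, ρ), z ^ m * (-u) ^ k * (1 + z + -u)⁻¹) = 0 := by
  obtain ⟨j, rfl⟩ : ∃ j : ℕ, m = -((j + 1 : ℕ) : ℤ) := ⟨(-m - 1).toNat, by omega⟩
  have h := circleIntegral_inv_pow_mul_inv_sub_of_lt hu j
  refine Eq.trans ?_ (mul_eq_zero_of_right ((-u) ^ k) h)
  rw [← circleIntegral.integral_const_mul]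
  congr 1 with z
  rw [zpow_neg, zpow_natCast, show 1 + z + -u = z - (u - 1) by ring]
  ring

theorem circleIntegral_inner_eq {ρ : ℝ} (hρ : 0 < ρ) {u : ℂ} (hu : ρ < ‖u - 1‖)
    {m : ℤ} (hm : m < 0) (k : ℤ) :
    (∮ z in C(0, ρ), z ^ m * (-u) ^ k * (1 + z + -u)⁻¹) =
      -(2 * π * I) * (u - 1) ^ m * (-u) ^ k := by
  obtain ⟨j, rfl⟩ : ∃ j : ℕ, m = -((j + 1 : ℕ) : ℤ) := ⟨(-m - 1).toNat, by omega⟩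
  have h := circleIntegral_inv_pow_mul_inv_sub_of_gt hρ hu j
  rw [zpow_neg, zpow_natCast, mul_comm _ ((-u) ^ k), ← h, ← circleIntegral.integral_const_mul]
  congr 1 with z
  rw [zpow_neg, zpow_natCast, show 1 + z + -u = z - (u - 1) by ring]
  ring

theorem circleIntegral_circleIntegral_eq_arc {ρ r θ : ℝ} (hρ : 0 < ρ) (hr : 0 < r)
    (h1 : 1 < ρ + r) (h2 : ρ < 1 + r) (h3 : r < 1 + ρ) (hθ : θ ∈ Set.Ioo 0 π)
    (hcos : ρ ^ 2 = r ^ 2 + 1 - 2 * r * Real.cos θ) {m : ℤ} (hm : m < 0) (k : ℤ) :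
    (∮ z in C(0, ρ), ∮ w in C(0, r), z ^ m * w ^ k * (1 + z + w)⁻¹) =
      2 * π * I * (-1) ^ k * ∫ φ in (θ - 2 * π)..(-θ),
        ((r : ℂ) * Complex.exp (I * φ) - 1) ^ m * ((r : ℂ) * Complex.exp (I * φ)) ^ k *
          (I * ((r : ℂ) * Complex.exp (I * φ))) := by
  obtain ⟨hθ0, hθπ⟩ := hθ
  rw [circleIntegral_swap hρ hr h1 h2 h3]
  set u : ℝ → ℂ := fun φ ↦ (r : ℂ) * Complex.exp (I * φ) with hu
  have hu0 (φ : ℝ) : u φ ≠ 0 := mul_ne_zero (by exact_mod_cast hr.ne') (Complex.exp_ne_zero _)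
  have hucont : Continuous u := by fun_prop
  have hmap (φ : ℝ) : circleMap 0 r (φ + π) = -u φ := by
    simp only [circleMap_zero, hu, ofReal_add, add_mul, Complex.exp_add, Complex.exp_pi_mul_I,
      mul_comm I]
    ring
  set g : ℝ → ℂ := fun β ↦ deriv (circleMap 0 r) β •
    ∮ z in C(0, ρ), z ^ m * circleMap 0 r β ^ k * (1 + z + circleMap 0 r β)⁻¹ with hg
  have hper : Function.Periodic g (2 * π) := fun β ↦ by
    simp only [hg, deriv_circleMap, periodic_circleMap 0 r β]
  have hshift : (∮ w in C(0, r), ∮ z in C(0, ρ), z ^ m * w ^ k * (1 + z + w)⁻¹) =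
      ∫ φ in (θ - 2 * π)..θ, g (φ + π) := by
    rw [intervalIntegral.integral_comp_add_right, circleIntegral,
      show θ + π = θ - 2 * π + π + 2 * π by ring, hper.intervalIntegral_add_eq _ 0, zero_add]
  have hinner : Set.EqOn (fun _ ↦ 0) (fun φ ↦ g (φ + π)) (Set.uIoo (-θ) θ) := fun φ hφ ↦ by
    rw [Set.uIoo_of_le (by linarith)] at hφ
    have hlt := cos_lt_cos_of_abs_lt hθπ.le (abs_lt.2 hφ)
    have hnorm : ‖u φ - 1‖ < ρ := lt_of_pow_lt_pow_left₀ 2 hρ.le (by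
      rw [norm_real_mul_exp_sub_one_sq, hcos]; nlinarith)
    simp only [hg, hmap, circleIntegral_inner_eq_zero hnorm hm, smul_zero]
  have houter : Set.EqOn
      (fun φ ↦ 2 * π * I * (-1) ^ k * ((u φ - 1) ^ m * u φ ^ k * (I * u φ)))
      (fun φ ↦ g (φ + π)) (Set.uIoo (θ - 2 * π) (-θ)) := fun φ hφ ↦ by
    rw [Set.uIoo_of_le (by linarith)] at hφ
    have hlt := cos_lt_cos_of_abs_lt (θ := π - θ) (φ := φ + π) (by linarith)
      (abs_lt.2 ⟨by linarith [hφ.1], by linarith [hφ.2]⟩)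
    rw [Real.cos_pi_sub, Real.cos_add_pi] at hlt
    have hnorm : ρ < ‖u φ - 1‖ := lt_of_pow_lt_pow_left₀ 2 (norm_nonneg _) (by
      rw [norm_real_mul_exp_sub_one_sq, hcos]; nlinarith)
    simp only [hg, hmap, deriv_circleMap, circleIntegral_inner_eq hρ hnorm hm, smul_eq_mul]
    generalize u φ = v
    rw [neg_eq_neg_one_mul v, mul_zpow]
    ring
  have hint : IntervalIntegrable
      (fun φ ↦ 2 * π * I * (-1) ^ k * ((u φ - 1) ^ m * u φ ^ k * (I * u φ))) volume
      (θ - 2 * π) (-θ) := by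
    refine ContinuousOn.intervalIntegrable (continuousOn_const.mul (((ContinuousOn.zpow₀
      (by fun_prop) m fun φ hφ ↦ Or.inl fun h0 ↦ ?_).mul
      (hucont.continuousOn.zpow₀ k fun φ _ ↦ Or.inl (hu0 φ))).mul (by fun_prop)))
    rw [Set.uIcc_of_le (by linarith)] at hφ
    have hle : Real.cos (π - θ) ≤ Real.cos (φ + π) := by
      rw [← Real.cos_abs (φ + π)]
      exact Real.cos_le_cos_of_nonneg_of_le_pi (abs_nonneg _) (by linarith)
        (abs_le.2 ⟨by linarith [hφ.1], by linarith [hφ.2]⟩)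
    rw [Real.cos_pi_sub, Real.cos_add_pi] at hle
    have hnorm := norm_real_mul_exp_sub_one_sq r φ
    change ‖u φ - 1‖ ^ 2 = _ at hnorm
    rw [h0, norm_zero] at hnorm
    nlinarith
  rw [hshift, ← intervalIntegral.integral_add_adjacent_intervals (hint.congr_uIoo houter)
    (intervalIntegrable_const.congr_uIoo hinner), ← intervalIntegral.integral_congr_uIoo hinner,
    ← intervalIntegral.integral_congr_uIoo houter, intervalIntegral.integral_zero, add_zero,
    intervalIntegral.integral_const_mul]

end


/-- Single-integral representation of the infinite-volume inverse Kasteleyn kernel,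
case `n < n'`: integration along the arc from `conj Ω` to `Ω := (c/a)e^{iθ}`
crossing the negative real axis. -/
theorem kernel_single_integral_neg (a b c : ℝ)
    (ha : 0 < a) (hb : 0 < b) (hc : 0 < c)
    (habc : a < b + c) (hbca : b < c + a) (hcab : c < a + b)
    (θ : ℝ) (hθ : θ ∈ Set.Ioo 0 Real.pi)
    (hcos : Real.cos θ = (a ^ 2 + c ^ 2 - b ^ 2) / (2 * a * c))
    (x x' n n' : ℤ) (h : n < n') :
    ((2 * (Real.pi : ℂ) * Complex.I) ^ 2)⁻¹ *
      (∮ z in C(0, b / a), ∮ w in C(0, c / a),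
        z ^ (n - n') * w ^ (n' - n + x' - x - 1) * (1 + z + w)⁻¹)
    = ((-1 : ℂ) ^ (n - n' + x - x') / (2 * (Real.pi : ℂ) * Complex.I)) *
      ∫ φ in (-θ)..(θ - 2 * Real.pi),
        (((c / a : ℝ) : ℂ) * Complex.exp (Complex.I * (φ : ℂ)) - 1) ^ (n - n') *
          (((c / a : ℝ) : ℂ) * Complex.exp (Complex.I * (φ : ℂ)))
            ^ (-(n - n' + x - x' + 1)) *
          (Complex.I * (((c / a : ℝ) : ℂ) * Complex.exp (Complex.I * (φ : ℂ)))) := by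
  rw [circleIntegral_circleIntegral_eq_arc (θ := θ) (div_pos hb ha) (div_pos hc ha) ?_ ?_ ?_ hθ ?_
    (sub_neg.2 h), intervalIntegral.integral_symm (θ - 2 * Real.pi) (-θ),
    show -(n - n' + x - x' + 1) = n' - n + x' - x - 1 by ring,
    show n - n' + x - x' = -(n' - n + x' - x - 1 + 1) by ring, zpow_neg, ← inv_zpow, inv_neg_one,
    zpow_add_one₀ (by norm_num)]
  · have := Complex.two_pi_I_ne_zero
    field_simp
  · rw [← add_div, one_lt_div ha]; exact habc
  · rw [one_add_div ha.ne']; gcongr; linarith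
  · rw [one_add_div ha.ne']; gcongr
  · rw [hcos]
    field_simp
    ring
end

section
/- Let G = (B,W) be a finite graph in the honeycomb dimer setup with a perfect matching M, let (x,n) ∈ ℤ² and let m ≥ 0 be an integer. Suppose that M(∘(x,n−i)) = •(x,n−i) for all 0 ≤ i ≤ m, that (x+1,n−m) ∈ W with M(∘(x+1,n−m)) = •(x+1,n−m−1), and that (x+1,n−i−1) ∈ B for all 0 ≤ i ≤ m−1. Then for every 0 ≤ i ≤ m−1 one has (x+1,n−i) ∈ W and M(∘(x+1,n−i)) = •(x+1,n−i−1). (Forcing of the dimers e_i^1 by the chain of dimers e_0^0,…,e_m^0 together with e_m^1.) -/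
/-- Adjacency of the honeycomb graph: the white vertex `∘(u,v)` is adjacent exactly
to the black vertices `•(u,v)`, `•(u,v−1)` and `•(u+1,v−1)`. -/
def HAdj (w b : ℤ × ℤ) : Prop :=
  b = w ∨ b = (w.1, w.2 - 1) ∨ b = (w.1 + 1, w.2 - 1)

/-- Forcing of the dimers `e_i^1` by the chain of dimers `e_0^0,…,e_m^0` together
with `e_m^1`.  Here `M` is a perfect matching of the finite honeycomb graph with
black vertex set `B` and white vertex set `W` (a bijection `W → B` matching each
white vertex to an adjacent black vertex). -/
theorem forced_dimers (B W : Finset (ℤ × ℤ)) (M : ℤ × ℤ → ℤ × ℤ)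
    (hmaps : ∀ w ∈ W, M w ∈ B)
    (hinj : Set.InjOn M (W : Set (ℤ × ℤ)))
    (hsurj : ∀ b ∈ B, ∃ w ∈ W, M w = b)
    (hadj : ∀ w ∈ W, HAdj w (M w))
    (x n : ℤ) (m : ℕ)
    (h0 : ∀ i : ℕ, i ≤ m →
      ((x, n - (i : ℤ)) : ℤ × ℤ) ∈ W ∧ M (x, n - (i : ℤ)) = (x, n - (i : ℤ)))
    (h1 : ((x + 1, n - (m : ℤ)) : ℤ × ℤ) ∈ W ∧
      M (x + 1, n - (m : ℤ)) = (x + 1, n - (m : ℤ) - 1))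
    (h2 : ∀ i : ℕ, i < m → ((x + 1, n - (i : ℤ) - 1) : ℤ × ℤ) ∈ B) :
    ∀ i : ℕ, i < m →
      ((x + 1, n - (i : ℤ)) : ℤ × ℤ) ∈ W ∧
        M (x + 1, n - (i : ℤ)) = (x + 1, n - (i : ℤ) - 1) := by
  have key : ∀ i : ℕ, i ≤ m → ((x + 1, n - (i : ℤ)) : ℤ × ℤ) ∈ W ∧
      M (x + 1, n - (i : ℤ)) = (x + 1, n - (i : ℤ) - 1) := by
    intro i hi
    induction hi using Nat.decreasingInduction with
    | self => exact h1
    | of_succ i hi ih =>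
      obtain ⟨⟨u, v⟩, hw, hM⟩ := hsurj _ (h2 i hi)
      have hx := (h0 i hi.le).2
      have ih' := ih.2
      push_cast at ih'
      have h := hadj _ hw
      rw [hM] at h
      simp only [HAdj, Prod.mk.injEq] at h
      rcases h with ⟨hu, hv⟩ | ⟨hu, hv⟩ | ⟨hu, hv⟩
      · obtain rfl : u = x + 1 := hu.symm
        obtain rfl : v = n - ((i : ℤ) + 1) := by lia
        rw [ih', Prod.mk.injEq] at hM
        lia
      · obtain rfl : u = x + 1 := hu.symm
        obtain rfl : v = n - (i : ℤ) := by lia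
        exact ⟨hw, hM⟩
      · obtain rfl : u = x := by lia
        obtain rfl : v = n - (i : ℤ) := by lia
        rw [hx, Prod.mk.injEq] at hM
        lia
  exact fun i hi => key i hi.le
end
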